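/- Let T = [[1, 0], [0, e^{iπ/4}]] be the single-qubit T-gate, and for π in the subgroup S₃ ⊆ S₄ (permutations fixing 4) define the 16×16 matrix a_π = r_π · (1/2)·Σ_{P∈{I,X,Y,Z}} P^{⊗4}, where r_π is the operator on (ℂ²)^{⊗4} permuting the four tensor factors according to π and I, X, Y, Z are the 2×2 identity and Pauli matrices. Then for all π, π′ ∈ S₃: tr( a_π† · T^{⊗4} · a_{π′} · (T†)^{⊗4} ) = tr( a_π† · a_{π′} ) − 4. -/

import Mathlib

open Matrix BigOperators

/-- The four single-qubit Pauli matrices `I, X, Y, Z`. -/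
noncomputable def pauli1 : Fin 4 → Matrix (Fin 2) (Fin 2) ℂ
  | 0 => 1
  | 1 => !![0, 1; 1, 0]
  | 2 => !![0, -Complex.I; Complex.I, 0]
  | 3 => !![1, 0; 0, -1]

/-- The fourth Kronecker power `M^{⊗4}` of a single-qubit operator, acting on
`(ℂ²)^{⊗4}` with product basis indexed by `Fin 4 → Fin 2`. -/
noncomputable def kron4 (M : Matrix (Fin 2) (Fin 2) ℂ) :
    Matrix (Fin 4 → Fin 2) (Fin 4 → Fin 2) ℂ :=
  fun x y => ∏ j, M (x j) (y j)

/-- The operator on `(ℂ²)^{⊗4}` permuting the four tensor factors according to `π`. -/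
noncomputable def permOp (π : Equiv.Perm (Fin 4)) :
    Matrix (Fin 4 → Fin 2) (Fin 4 → Fin 2) ℂ :=
  fun z y => if z = y ∘ π then 1 else 0

/-- The single-qubit T-gate `T = diag(1, e^{iπ/4})`. -/
noncomputable def Tgate : Matrix (Fin 2) (Fin 2) ℂ :=
  !![1, 0; 0, Complex.exp (Complex.I * (Real.pi / 4))]

/-- `a_π = r_π · (1/2)·Σ_{P∈{I,X,Y,Z}} P^{⊗4}`, for `π` in the subgroup `S₃ ⊆ S₄`. -/
noncomputable def aOp (π : Equiv.Perm (Fin 4)) :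
    Matrix (Fin 4 → Fin 2) (Fin 4 → Fin 2) ℂ :=
  permOp π * ((1 / 2 : ℂ) • ∑ p : Fin 4, kron4 (pauli1 p))

/-- The Hamming weight of a bit string. -/
def bitWeight (x : Fin 4 → Fin 2) : ℕ := ∑ j, (x j : ℕ)

lemma bitWeight_comp_perm (x : Fin 4 → Fin 2) (σ : Equiv.Perm (Fin 4)) :
    bitWeight (x ∘ σ) = bitWeight x :=
  Equiv.sum_comp σ fun j => (x j : ℕ)

/-- Each Pauli matrix either preserves or flips every bit, and the fourth powers cancel on
odd weights. -/
lemma bitWeight_eq_or_of_sum_kron4_pauli1_ne_zero (w x : Fin 4 → Fin 2)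
    (h : (∑ p : Fin 4, kron4 (pauli1 p)) w x ≠ 0) :
    bitWeight w = bitWeight x ∨ (w = 0 ∧ x = 1) ∨ (w = 1 ∧ x = 0) := by
  contrapose! h
  simp only [bitWeight, ne_eq, funext_iff, Fin.forall_fin_succ, Fin.sum_univ_four, Matrix.sum_apply,
    kron4, Fin.prod_univ_four, pauli1] at h ⊢
  simp only [Fin.succ_zero_eq_one, Fin.succ_one_eq_two, Pi.zero_apply, Pi.one_apply] at h
  simp only [show Fin.succ (2 : Fin 3) = 3 from rfl, IsEmpty.forall_iff, and_true] at h
  generalize w 0 = a, w 1 = b, w 2 = c, w 3 = d, x 0 = a', x 1 = b', x 2 = c', x 3 = d' at h ⊢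
  fin_cases a <;> fin_cases b <;> fin_cases c <;> fin_cases d <;> fin_cases a' <;>
    fin_cases b' <;> fin_cases c' <;> fin_cases d' <;> simp_all

lemma aOp_apply (π : Equiv.Perm (Fin 4)) (z x : Fin 4 → Fin 2) :
    aOp π z x = 1 / 2 * (∑ p : Fin 4, kron4 (pauli1 p)) (z ∘ π.symm) x := by
  have h (w : Fin 4 → Fin 2) : z = w ∘ π ↔ w = z ∘ π.symm := by
    rw [Equiv.eq_comp_symm, eq_comm]
  simp only [aOp, Matrix.mul_apply, permOp, h, ite_mul, one_mul, zero_mul, Finset.sum_ite_eq',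
    Finset.mem_univ, if_true, Matrix.smul_apply, smul_eq_mul]

lemma bitWeight_eq_or_of_aOp_ne_zero {π : Equiv.Perm (Fin 4)} {z x : Fin 4 → Fin 2}
    (h : aOp π z x ≠ 0) :
    bitWeight z = bitWeight x ∨ (z = 0 ∧ x = 1) ∨ (z = 1 ∧ x = 0) := by
  rw [aOp_apply] at h
  have := bitWeight_eq_or_of_sum_kron4_pauli1_ne_zero _ _ (right_ne_zero_of_mul h)
  rwa [bitWeight_comp_perm, Equiv.comp_symm_eq, Equiv.comp_symm_eq] at this

lemma aOp_zero_one (π : Equiv.Perm (Fin 4)) : aOp π 0 1 = 1 := by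
  rw [aOp_apply]
  simp [Fin.sum_univ_four, Matrix.sum_apply, kron4, pauli1]
  norm_num

lemma aOp_one_zero (π : Equiv.Perm (Fin 4)) : aOp π 1 0 = 1 := by
  rw [aOp_apply]
  simp [Fin.sum_univ_four, Matrix.sum_apply, kron4, pauli1]
  norm_num

lemma kron4_Tgate :
    kron4 Tgate =
      diagonal fun x => Complex.exp (Complex.I * (Real.pi / 4)) ^ bitWeight x := by
  have hT : Tgate = diagonal fun i : Fin 2 =>
      Complex.exp (Complex.I * (Real.pi / 4)) ^ (i : ℕ) := by
    ext i j
    fin_cases i <;> fin_cases j <;> simp [Tgate]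
  ext x y
  rw [hT, kron4]
  by_cases h : x = y
  · subst h
    simp [bitWeight, Finset.prod_pow_eq_pow_sum]
  · obtain ⟨j, hj⟩ := Function.ne_iff.mp h
    rw [diagonal_apply_ne _ h]
    exact Finset.prod_eq_zero (Finset.mem_univ j) (diagonal_apply_ne _ hj)

/-- Conjugation by diagonal matrices multiplies each entry of `B` by a phase. -/
lemma trace_conjTranspose_mul_diagonal_mul {n : Type*} [Fintype n] [DecidableEq n]
    (A B : Matrix n n ℂ) (t : n → ℂ) :
    (Aᴴ * diagonal t * B * (diagonal t)ᴴ).trace =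
      ∑ x, ∑ z, star (A z x) * B z x * (t z * star (t x)) := by
  simp only [trace, diag_apply, diagonal_conjTranspose, mul_diagonal]
  simp only [mul_apply (M := _ * diagonal t), mul_diagonal, conjTranspose_apply, Finset.sum_mul,
    Pi.star_apply]
  exact Finset.sum_congr rfl fun x _ => Finset.sum_congr rfl fun z _ => by ring

/-- **Single-qubit core of Lemma (t_gate)**: for all `π, π′` in the subgroup `S₃ ⊆ S₄` of
permutations fixing the fourth factor,
`tr(a_π† · T^{⊗4} · a_{π′} · (T†)^{⊗4}) = tr(a_π† · a_{π′}) − 4`. -/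
theorem t_gate_contraction (π π' : Equiv.Perm (Fin 4)) (hπ : π 3 = 3) (hπ' : π' 3 = 3) :
    ((aOp π)ᴴ * kron4 Tgate * aOp π' * (kron4 Tgate)ᴴ).trace =
      ((aOp π)ᴴ * aOp π').trace - 4 := by
  rw [kron4_Tgate, trace_conjTranspose_mul_diagonal_mul]
  set ω := Complex.exp (Complex.I * (Real.pi / 4)) with hω
  have hω4 : ω ^ 4 = -1 := by
    rw [hω, ← Complex.exp_nat_mul, ← Complex.exp_pi_mul_I]
    congr 1
    push_cast
    ring
  have hω1 : ω * star ω = 1 := by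
    rw [hω, Complex.star_def, ← Complex.exp_conj, ← Complex.exp_add, ← Complex.exp_zero]
    congr 1
    simp [Complex.conj_ofNat]
  have h0 : bitWeight 0 = 0 := by simp [bitWeight]
  have h1 : bitWeight 1 = 4 := by simp [bitWeight]
  have hne : (0 : Fin 4 → Fin 2) ≠ 1 := by decide
  have key (x z : Fin 4 → Fin 2) :
      star (aOp π z x) * aOp π' z x * (ω ^ bitWeight z * star (ω ^ bitWeight x)) =
        star (aOp π z x) * aOp π' z x -
          ((if x = 1 then if z = 0 then 2 else 0 else 0) +
            if x = 0 then if z = 1 then 2 else 0 else 0) := by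
    by_cases h01 : z = 0 ∧ x = 1
    · obtain ⟨rfl, rfl⟩ := h01
      simp only [aOp_zero_one, h0, h1, hω4, hne, hne.symm, if_true, if_false]
      norm_num
    by_cases h10 : z = 1 ∧ x = 0
    · obtain ⟨rfl, rfl⟩ := h10
      simp only [aOp_one_zero, h0, h1, hω4, hne, hne.symm, if_true, if_false]
      norm_num
    have hz : ((if x = 1 then if z = 0 then 2 else 0 else 0) +
        if x = 0 then if z = 1 then 2 else 0 else 0 : ℂ) = 0 := by
      grind
    rw [hz, sub_zero]
    by_cases ha : aOp π z x = 0
    · simp [ha]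
    · obtain hw | hw | hw := bitWeight_eq_or_of_aOp_ne_zero ha
      · rw [hw, star_pow, ← mul_pow, hω1, one_pow, mul_one]
      · exact absurd hw h01
      · exact absurd hw h10
  simp only [key, Finset.sum_sub_distrib, Finset.sum_add_distrib]
  congr 1
  simp
  norm_num
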